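/- arXiv:0802.1226 — 3 statements merged into one kernel-verified Lean document; each statement's English description precedes it below -/
import Mathlib

section
/- Let B be an NGBW over an alphabet Σ and let W be a finite conflict set for B. Then every nondeterministic Streett word automaton (NSW) accepting the complement Σ^ω \ L(B) has at least |W| states. -/
namespace YanPaper

/-- A finite run, represented as the list of visited states, over a finite word. -/
def RunOn {S A : Type*} (Δ : S → A → S → Prop) : List S → List A → Prop
  | [_], [] => True
  | p :: q :: ρ, a :: w => Δ p a q ∧ RunOn Δ (q :: ρ) w
  | _, _ => False

/-- `p` reaches `q` via some finite run over the word `w`. -/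
def Reaches {S A : Type*} (Δ : S → A → S → Prop) (p : S) (w : List A) (q : S) : Prop :=
  ∃ ρ : List S, RunOn Δ ρ w ∧ ρ.head? = some p ∧ ρ.getLast? = some q

/-- `p` reaches `q` via some finite run over `w` that visits the set `T`. -/
def ReachesVisit {S A : Type*} (Δ : S → A → S → Prop) (T : Set S) (p : S) (w : List A)
    (q : S) : Prop :=
  ∃ ρ : List S, RunOn Δ ρ w ∧ ρ.head? = some p ∧ ρ.getLast? = some q ∧ ∃ s ∈ ρ, s ∈ T

/-- Nondeterministic finite word automaton. -/
structure NFW (A : Type*) (S : Type*) where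
  I : Set S
  Δ : S → A → S → Prop
  F : Set S

def NFW.Lang {A S : Type*} (M : NFW A S) : Set (List A) :=
  {w | ∃ p ∈ M.I, ∃ q ∈ M.F, Reaches M.Δ p w q}

/-- The full NFW over state set `S`: the alphabet is the set of all binary relations on `S`. -/
def FullNFW (S : Type*) (I F : Set S) : NFW (Set (S × S)) S where
  I := I
  Δ := fun p a q => (p, q) ∈ a
  F := F

/-- Minimal number of states of an NFW over alphabet `A` accepting the language `L`. -/
noncomputable def NFWminStates (A : Type*) (L : Set (List A)) : ℕ :=
  sInf {c : ℕ | ∃ C : NFW A (Fin c), C.Lang = L}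

/-- A two letter alphabet. -/
inductive AB : Type
  | a : AB
  | b : AB

/-- States occurring infinitely often in an infinite run. -/
def InfOcc {S : Type*} (ρ : ℕ → S) : Set S := {s | ∀ n : ℕ, ∃ m, n ≤ m ∧ ρ m = s}

/-- Nondeterministic Büchi word automaton. -/
structure NBW (A : Type*) (S : Type*) where
  I : Set S
  Δ : S → A → S → Prop
  F : Set S

def NBW.Lang {A S : Type*} (M : NBW A S) : Set (ℕ → A) :=
  {α | ∃ ρ : ℕ → S, ρ 0 ∈ M.I ∧ (∀ i, M.Δ (ρ i) (α i) (ρ (i + 1))) ∧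
        (InfOcc ρ ∩ M.F).Nonempty}

/-- The full NBW over state set `S`. -/
def FullNBW (S : Type*) (I F : Set S) : NBW (Set (S × S)) S where
  I := I
  Δ := fun p a q => (p, q) ∈ a
  F := F

/-- Minimal number of states of an NBW over alphabet `A` accepting the ω-language `L`. -/
noncomputable def NBWminStates (A : Type*) (L : Set (ℕ → A)) : ℕ :=
  sInf {c : ℕ | ∃ C : NBW A (Fin c), C.Lang = L}

/-- Vertex `(q, l)` of the Δ-graph of `α` is reachable from an initial vertex `(q_I, 0)`. -/
def GraphReach {A S : Type*} (M : NBW A S) (α : ℕ → A) (q : S) (l : ℕ) : Prop :=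
  ∃ ρ : ℕ → S, ρ 0 ∈ M.I ∧ (∀ i, i < l → M.Δ (ρ i) (α i) (ρ (i + 1))) ∧ ρ l = q

/-- A co-Büchi ranking for the Δ-graph of `α` under `M`, as a partial function
`S × ℕ → {0, …, 2n-2}` represented with `Option ℕ`. -/
def CRanking {A S : Type*} [Fintype S] (M : NBW A S) (α : ℕ → A)
    (f : S → ℕ → Option ℕ) : Prop :=
  (∀ q l r, f q l = some r → r ≤ 2 * Fintype.card S - 2) ∧
  (∀ q l, (f q l).isSome ↔ GraphReach M α q l) ∧
  (∀ q l r, f q l = some r → Odd r → q ∉ M.F) ∧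
  (∀ q l q', M.Δ q (α l) q' → ∀ r r', f q l = some r → f q' (l + 1) = some r' → r' ≤ r)

/-- The C-ranking `f` is odd: every infinite path of the Δ-graph starting at an initial
vertex has infinitely many odd-ranked vertices. -/
def OddCRanking {A S : Type*} [Fintype S] (M : NBW A S) (α : ℕ → A)
    (f : S → ℕ → Option ℕ) : Prop :=
  ∀ ρ : ℕ → S, ρ 0 ∈ M.I → (∀ i, M.Δ (ρ i) (α i) (ρ (i + 1))) →
    ∀ N : ℕ, ∃ l, N ≤ l ∧ ∃ r, f (ρ l) l = some r ∧ Odd r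

/-- The state space of the full NBW `FB n`: `none` is the final state `s_f`, and
`some i` is the main state `s_i`. -/
abbrev FBState (n : ℕ) := Option (Fin (n - 1))

/-- The alphabet of a full automaton with state space `FBState n`. -/
abbrev FBAlpha (n : ℕ) := Set (FBState n × FBState n)

/-- The full NBW `FB n`, with `n` states, main states initial and `s_f = none` final. -/
def FB (n : ℕ) : NBW (FBAlpha n) (FBState n) where
  I := {s | s ≠ none}
  Δ := fun p a q => (p, q) ∈ a
  F := {none}

/-- A `Q(m)`-ranking for `FB n`: a function on the main states with values in
`{0, …, 2m-1}` whose range contains all odd numbers in `{0, …, 2m-1}`. -/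
def QRanking (n m : ℕ) (g : Fin (n - 1) → ℕ) : Prop :=
  (∀ q, g q < 2 * m) ∧ ∀ r, r < 2 * m → Odd r → ∃ q, g q = r

/-- `w` is an `(f, g)`-segment for `FB n` (properties (P1), (P2), (P3)). -/
def IsSeg (n : ℕ) (f g : Fin (n - 1) → ℕ) (w : List (FBAlpha n)) : Prop :=
  w ≠ [] ∧
  (∀ p q : Fin (n - 1),
    Reaches (FB n).Δ (some p) w (some q) ↔ (g q < f p ∨ (f p = g q ∧ Odd (f p)))) ∧
  (∀ p q : Fin (n - 1),
    ReachesVisit (FB n).Δ {none} (some p) w (some q) ↔ g q < f p) ∧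
  (∀ p q : FBState n, Reaches (FB n).Δ p w q → p ≠ none ∧ q ≠ none)

/-- `L(n, m)`: the number of `Q(m)`-rankings for `FB n`. -/
noncomputable def Lnm (n m : ℕ) : ℕ := Nat.card {g : Fin (n - 1) → ℕ // QRanking n m g}

/-- `L(n) = max_{1 ≤ m < n} L(n, m)`. -/
noncomputable def Lmax (n : ℕ) : ℕ := (Finset.Ico 1 n).sup (fun m => Lnm n m)

/-- Nondeterministic Muller word automaton. -/
structure NMW (A : Type*) (S : Type*) where
  I : Set S
  Δ : S → A → S → Prop
  Acc : Set (Set S)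

def NMW.Lang {A S : Type*} (M : NMW A S) : Set (ℕ → A) :=
  {α | ∃ ρ : ℕ → S, ρ 0 ∈ M.I ∧ (∀ i, M.Δ (ρ i) (α i) (ρ (i + 1))) ∧ InfOcc ρ ∈ M.Acc}

/-- Nondeterministic generalized Büchi word automaton of index `k`. -/
structure NGBW (A : Type*) (S : Type*) where
  I : Set S
  Δ : S → A → S → Prop
  k : ℕ
  F : Fin k → Set S

def NGBW.Lang {A S : Type*} (M : NGBW A S) : Set (ℕ → A) :=
  {α | ∃ ρ : ℕ → S, ρ 0 ∈ M.I ∧ (∀ i, M.Δ (ρ i) (α i) (ρ (i + 1))) ∧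
        ∀ i, (InfOcc ρ ∩ M.F i).Nonempty}

/-- Nondeterministic Streett word automaton of index `k`. -/
structure NSW (A : Type*) (S : Type*) where
  I : Set S
  Δ : S → A → S → Prop
  k : ℕ
  acc : Fin k → Set S × Set S

def NSW.Lang {A S : Type*} (M : NSW A S) : Set (ℕ → A) :=
  {α | ∃ ρ : ℕ → S, ρ 0 ∈ M.I ∧ (∀ i, M.Δ (ρ i) (α i) (ρ (i + 1))) ∧
        ∀ i, (InfOcc ρ ∩ (M.acc i).2).Nonempty → (InfOcc ρ ∩ (M.acc i).1).Nonempty}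

/-- Nondeterministic Rabin word automaton of index `k`. -/
structure NRW (A : Type*) (S : Type*) where
  I : Set S
  Δ : S → A → S → Prop
  k : ℕ
  acc : Fin k → Set S × Set S

def NRW.Lang {A S : Type*} (M : NRW A S) : Set (ℕ → A) :=
  {α | ∃ ρ : ℕ → S, ρ 0 ∈ M.I ∧ (∀ i, M.Δ (ρ i) (α i) (ρ (i + 1))) ∧
        ∃ i, (InfOcc ρ ∩ (M.acc i).1).Nonempty ∧ InfOcc ρ ∩ (M.acc i).2 = ∅}

/-- The `k`-fold concatenation `w^k` of a finite word. -/
def listPow {A : Type*} (w : List A) (k : ℕ) : List A := (List.replicate k w).flatten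

/-- `α` is the ω-word `u · v^ω`. -/
def IsUVOmega {A : Type*} (u v : List A) (α : ℕ → A) : Prop :=
  (∀ i (h : i < u.length), α i = u.get ⟨i, h⟩) ∧
  (∀ i j (h : j < v.length), α (u.length + i * v.length + j) = v.get ⟨j, h⟩)

/-- A GC-segment of the NGBW `B`: a nonempty finite word `w` with `w^ω ∉ L(B)`. -/
def GCSeg {A S : Type*} (B : NGBW A S) (w : List A) : Prop :=
  w ≠ [] ∧ ∀ α, IsUVOmega [] w α → α ∉ B.Lang

/-- Two GC-segments conflict: every ω-word `w₁^{k₀} (w₁^{k₁} w₂^{k₂})^ω` is in `L(B)`. -/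
def Conflict {A S : Type*} (B : NGBW A S) (w₁ w₂ : List A) : Prop :=
  ∀ k₀ k₁ k₂ : ℕ, 0 < k₀ → 0 < k₁ → 0 < k₂ →
    ∀ α, IsUVOmega (listPow w₁ k₀) (listPow w₁ k₁ ++ listPow w₂ k₂) α → α ∈ B.Lang

/-- The full NGBW `FB (n,k)` with all states initial, distinguished state `s_nf = none`,
and acceptance sets `F i` (subsets of the main states). -/
def FBgen (n k : ℕ) (F : Fin k → Finset (Fin (n - 1))) :
    NGBW (FBAlpha n) (FBState n) where
  I := Set.univ
  Δ := fun p a q => (p, q) ∈ a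
  k := k
  F := fun i => {s | ∃ q ∈ F i, s = some q}

/-- The conditions on the acceptance condition of `FB (n,k)`: the sets are pairwise
distinct, each of size `⌊(n-1)/2⌋`, and each main state avoids at least `⌊k/2⌋` sets. -/
def GoodAcc (n k : ℕ) (F : Fin k → Finset (Fin (n - 1))) : Prop :=
  Function.Injective F ∧ (∀ i, (F i).card = (n - 1) / 2) ∧
  ∀ q : Fin (n - 1), k / 2 ≤ {i : Fin k | q ∉ F i}.ncard

/-- A PGCL-ranking for `FB (n,k)`: `f` is a bijection from the main states onto
`{1, …, n-1}` and `g` chooses for each main state `q` an index with `q ∉ F (g q)`. -/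
def PGCL (n k : ℕ) (F : Fin k → Finset (Fin (n - 1)))
    (f : Fin (n - 1) → ℕ) (g : Fin (n - 1) → Fin k) : Prop :=
  (∀ p, 1 ≤ f p ∧ f p ≤ n - 1) ∧ Function.Injective f ∧
  (∀ r, 1 ≤ r → r ≤ n - 1 → ∃ p, f p = r) ∧
  ∀ q, q ∉ F (g q)

/-- `ρ` is a finite run over `w` from `p` to `q`. -/
def RunFromTo {S A : Type*} (Δ : S → A → S → Prop) (w : List A) (p q : S)
    (ρ : List S) : Prop :=
  RunOn Δ ρ w ∧ ρ.head? = some p ∧ ρ.getLast? = some q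

/-- `w` is an `⟨f, g⟩`-segment for `FB (n,k)` (properties (Q0)–(Q3)). -/
def IsSegGen (n k : ℕ) (F : Fin k → Finset (Fin (n - 1)))
    (f : Fin (n - 1) → ℕ) (g : Fin (n - 1) → Fin k)
    (w : List (FBAlpha n)) : Prop :=
  w ≠ [] ∧
  -- (Q0) every finite run over `w` ends in a main state
  (∀ (ρ : List (FBState n)) (x : FBState n),
    RunOn (FBgen n k F).Δ ρ w → ρ.getLast? = some x → x ≠ none) ∧
  -- (Q1)
  (∀ p : Fin (n - 1),
    (∃! ρ, RunFromTo (FBgen n k F).Δ w (some p) (some p) ρ) ∧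
    ∀ ρ, RunFromTo (FBgen n k F).Δ w (some p) (some p) ρ →
      (∀ i, i ≠ g p → ∃ s ∈ ρ, ∃ q ∈ F i, s = some q) ∧
      (∀ s ∈ ρ, ∀ q ∈ F (g p), s ≠ some q)) ∧
  -- (Q2)
  (∀ p q : Fin (n - 1), f q < f p →
    (∃! ρ, RunFromTo (FBgen n k F).Δ w (some p) (some q) ρ) ∧
    ∀ ρ, RunFromTo (FBgen n k F).Δ w (some p) (some q) ρ →
      ∀ i, ∃ s ∈ ρ, ∃ r ∈ F i, s = some r) ∧
  -- (Q3)
  (∀ p q : Fin (n - 1), f p < f q →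
    ¬∃ ρ, RunFromTo (FBgen n k F).Δ w (some p) (some q) ρ)

theorem listPow_length {A : Type*} (w : List A) (k : ℕ) :
    (listPow w k).length = k * w.length := by
  simp [listPow]

theorem listPow_get? {A : Type*} (w : List A) (k i : ℕ) (h : i < k * w.length) :
    (listPow w k)[i]? = w[i % w.length]? := by
  induction k generalizing i with
  | zero => simp at h
  | succ k ih =>
    have e : listPow w (k + 1) = w ++ listPow w k := by
      simp [listPow, List.replicate_succ]
    rw [e]
    by_cases hi : i < w.length
    · rw [List.getElem?_append_left hi, Nat.mod_eq_of_lt hi]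
    · push Not at hi
      rw [List.getElem?_append_right hi, ih, ← Nat.mod_eq_sub_mod hi]
      rw [Nat.succ_mul] at h
      omega

theorem seg_data {A T : Type} [Fintype T] (C : NSW A T) (L : ℕ) (hL : 0 < L) (α : ℕ → A)
    (hα : α ∈ C.Lang) :
    ∃ (q : T) (k₀ k₁ : ℕ) (ρ : ℕ → T), 0 < k₀ ∧ 0 < k₁ ∧ ρ 0 ∈ C.I ∧
      (∀ i, C.Δ (ρ i) (α i) (ρ (i + 1))) ∧ ρ (k₀ * L) = q ∧ ρ (k₀ * L + k₁ * L) = q ∧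
      ∀ i, (∃ m < k₁ * L, ρ (k₀ * L + m) ∈ (C.acc i).2) →
        (∃ m < k₁ * L, ρ (k₀ * L + m) ∈ (C.acc i).1) := by
  classical
  obtain ⟨ρ, h0, hρ, hacc⟩ := hα
  have h1 : ∀ s, ∃ n, s ∉ InfOcc ρ → ∀ m, n ≤ m → ρ m ≠ s := by
    intro s
    by_cases hs : s ∈ InfOcc ρ
    · exact ⟨0, fun h => absurd hs h⟩
    · simp only [InfOcc, Set.mem_setOf_eq] at hs
      push Not at hs
      obtain ⟨n, hn⟩ := hs
      exact ⟨n, fun _ => hn⟩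
  choose N hN using h1
  obtain ⟨q, hq⟩ := Finite.exists_infinite_fiber (fun k : ℕ => ρ (k * L))
  have hq' := Set.infinite_coe_iff.mp hq
  have hq2 : ∀ n, ∃ k, n < k ∧ ρ (k * L) = q := by
    intro n
    obtain ⟨k, hk, hk2⟩ := hq'.exists_gt n
    exact ⟨k, hk2, hk⟩
  obtain ⟨k₀, hk0, hk0q⟩ := hq2 (Finset.univ.sup N)
  have h2 : ∀ s, ∃ m, s ∈ InfOcc ρ → k₀ * L ≤ m ∧ ρ m = s := by
    intro s
    by_cases hs : s ∈ InfOcc ρ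
    · obtain ⟨m, hm⟩ := hs (k₀ * L)
      exact ⟨m, fun _ => hm⟩
    · exact ⟨0, fun h => absurd h hs⟩
  choose M hM using h2
  obtain ⟨k₂, hk2, hk2q⟩ := hq2 (max k₀ (Finset.univ.sup M))
  have hk02 : k₀ < k₂ := lt_of_le_of_lt (le_max_left _ _) hk2
  have hMk : ∀ s, M s < k₂ := fun s =>
    lt_of_le_of_lt ((Finset.le_sup (Finset.mem_univ s)).trans (le_max_right _ _)) hk2
  have hsum : k₀ * L + (k₂ - k₀) * L = k₂ * L := by
    rw [← Nat.add_mul]; congr 1; omega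
  refine ⟨q, k₀, k₂ - k₀, ρ, by omega, by omega, h0, hρ, hk0q, by rw [hsum]; exact hk2q, ?_⟩
  rintro i ⟨m, hm, hmB⟩
  have hinf : ρ (k₀ * L + m) ∈ InfOcc ρ := by
    by_contra hc
    refine hN _ hc (k₀ * L + m) ?_ rfl
    have : N (ρ (k₀ * L + m)) ≤ Finset.univ.sup N := Finset.le_sup (Finset.mem_univ _)
    nlinarith
  obtain ⟨s, hs, hsG⟩ := hacc i ⟨_, hinf, hmB⟩
  obtain ⟨h3, h4⟩ := hM s hs
  have h5 := hMk s
  refine ⟨M s - k₀ * L, ?_, ?_⟩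
  · have : k₂ ≤ k₂ * L := Nat.le_mul_of_pos_right _ hL
    omega
  · rw [Nat.add_sub_cancel' h3, h4]; exact hsG

/-- Lasso-combination of two sequences. -/
def comb {X : Type*} (a b u v : ℕ) (f g : ℕ → X) (n : ℕ) : X :=
  if n < a then f n
  else if (n - a) % (u + v) < u then f (a + (n - a) % (u + v))
  else g (b + ((n - a) % (u + v) - u))

theorem comb_at {X : Type*} (a b u v : ℕ) (f g : ℕ → X) (i j : ℕ) (hj : j < u + v) :
    comb a b u v f g (a + i * (u + v) + j) = if j < u then f (a + j) else g (b + (j - u)) := by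
  have e : (a + i * (u + v) + j - a) % (u + v) = j := by
    have : a + i * (u + v) + j - a = j + i * (u + v) := by omega
    rw [this, Nat.add_mul_mod_self_right, Nat.mod_eq_of_lt hj]
  have : ¬ (a + i * (u + v) + j < a) := by omega
  simp only [comb, if_neg this, e]

theorem exists_form (a p n : ℕ) (hp : 0 < p) (h : a ≤ n) : ∃ i j, j < p ∧ n = a + i * p + j := by
  refine ⟨(n - a) / p, (n - a) % p, Nat.mod_lt _ hp, ?_⟩
  have := Nat.div_add_mod' (n - a) p
  omega

theorem comb_run {A T : Type} (C : NSW A T) (a b u v : ℕ) (hu : 0 < u) (hv : 0 < v)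
    (α β : ℕ → A) (ρ σ : ℕ → T) (h0 : ρ 0 ∈ C.I)
    (hρ : ∀ i, C.Δ (ρ i) (α i) (ρ (i + 1))) (hσ : ∀ i, C.Δ (σ i) (β i) (σ (i + 1)))
    (q : T) (h1 : ρ a = q) (h2 : ρ (a + u) = q) (h3 : σ b = q) (h4 : σ (b + v) = q)
    (hA : ∀ i, (∃ m < u, ρ (a + m) ∈ (C.acc i).2) → (∃ m < u, ρ (a + m) ∈ (C.acc i).1))
    (hB : ∀ i, (∃ m < v, σ (b + m) ∈ (C.acc i).2) → (∃ m < v, σ (b + m) ∈ (C.acc i).1)) :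
    comb a b u v α β ∈ C.Lang := by
  have hinfA : ∀ m < u, ρ (a + m) ∈ InfOcc (comb a b u v ρ σ) := by
    intro m hm n
    refine ⟨a + n * (u + v) + m, ?_, ?_⟩
    · have : n ≤ n * (u + v) := Nat.le_mul_of_pos_right _ (by omega)
      omega
    · rw [comb_at _ _ _ _ _ _ _ _ (by omega), if_pos hm]
  have hinfB : ∀ m < v, σ (b + m) ∈ InfOcc (comb a b u v ρ σ) := by
    intro m hm n
    refine ⟨a + n * (u + v) + (u + m), ?_, ?_⟩
    · have : n ≤ n * (u + v) := Nat.le_mul_of_pos_right _ (by omega)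
      omega
    · rw [comb_at _ _ _ _ _ _ _ _ (by omega), if_neg (by omega)]
      congr 2; omega
  refine ⟨comb a b u v ρ σ, ?_, ?_, ?_⟩
  · by_cases ha : 0 < a
    · simpa [comb, ha] using h0
    · have : a = 0 := by omega
      subst this
      simpa [comb, hu] using h0
  · intro n
    by_cases hn : n < a
    · have e : comb a b u v ρ σ (n + 1) = ρ (n + 1) := by
        by_cases hn' : n + 1 < a
        · simp [comb, hn']
        · have : n + 1 = a := by omega
          simp [comb, this, hu]
      rw [e]
      simpa [comb, hn] using hρ n
    · obtain ⟨i, j, hj, rfl⟩ := exists_form a (u + v) n (by omega) (by omega)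
      rw [comb_at _ _ _ _ _ _ _ _ hj, comb_at _ _ _ _ _ _ _ _ hj]
      by_cases hl : j + 1 < u + v
      · rw [Nat.add_assoc _ j 1, comb_at _ _ _ _ _ _ _ _ hl]
        by_cases hju : j + 1 < u
        · rw [if_pos (by omega), if_pos (by omega), if_pos hju]
          exact hρ (a + j)
        · rw [if_neg hju]
          by_cases hje : j < u
          · have : j + 1 = u := by omega
            rw [if_pos hje, if_pos hje, this]
            have h := hρ (a + j)
            rw [Nat.add_assoc, this, h2] at h
            simpa [h3] using h
          · rw [if_neg hje, if_neg hje]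
            have h := hσ (b + (j - u))
            rwa [show b + (j - u) + 1 = b + (j + 1 - u) by omega] at h
      · have e : a + i * (u + v) + j + 1 = a + (i + 1) * (u + v) + 0 := by
          rw [Nat.succ_mul]; omega
        rw [e, comb_at _ _ _ _ _ _ _ _ (by omega), if_neg (by omega), if_neg (by omega),
          if_pos hu, Nat.add_zero, h1, ← h4]
        have h := hσ (b + (j - u))
        rwa [show b + (j - u) + 1 = b + v by omega] at h
  · rintro i ⟨s, hs, hsB⟩
    obtain ⟨n, hn, rfl⟩ := hs a
    obtain ⟨k, j, hj, rfl⟩ := exists_form a (u + v) n (by omega) hn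
    rw [comb_at _ _ _ _ _ _ _ _ hj] at hsB
    by_cases hju : j < u
    · rw [if_pos hju] at hsB
      obtain ⟨m, hm, hmG⟩ := hA i ⟨j, hju, hsB⟩
      exact ⟨_, hinfA m hm, hmG⟩
    · rw [if_neg hju] at hsB
      obtain ⟨m, hm, hmG⟩ := hB i ⟨j - u, by omega, hsB⟩
      exact ⟨_, hinfB m hm, hmG⟩

theorem comb_word {A : Type} (w x : List A) (k₀ k₁ l₀ l₁ : ℕ)
    (α β : ℕ → A) (hα : ∀ n, some (α n) = w[n % w.length]?)
    (hβ : ∀ n, some (β n) = x[n % x.length]?) (h1 : 0 < k₁ * w.length) :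
    IsUVOmega (listPow w k₀) (listPow w k₁ ++ listPow x l₁)
      (comb (k₀ * w.length) (l₀ * x.length) (k₁ * w.length) (l₁ * x.length) α β) := by
  constructor
  · intro i h
    rw [listPow_length] at h
    apply Option.some_injective
    simp only [List.get_eq_getElem]
    rw [← List.getElem?_eq_getElem, listPow_get? _ _ _ h]
    simp [comb, h, hα]
  · intro i j h
    have h' := h
    simp only [List.length_append, listPow_length] at h' ⊢
    rw [comb_at _ _ _ _ _ _ _ _ h']
    apply Option.some_injective
    simp only [List.get_eq_getElem]
    rw [← List.getElem?_eq_getElem]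
    by_cases hj : j < k₁ * w.length
    · rw [if_pos hj, List.getElem?_append_left (by rw [listPow_length]; exact hj),
        listPow_get? _ _ _ hj, hα, Nat.add_comm, Nat.add_mul_mod_self_right]
    · rw [if_neg hj, List.getElem?_append_right (by rw [listPow_length]; omega), listPow_length,
        listPow_get? _ _ _ (by omega), hβ, Nat.add_comm, Nat.add_mul_mod_self_right]

/-- if `W` is a finite conflict set for the NGBW `B`, then every
nondeterministic Streett automaton accepting the complement of `L(B)` has at least `|W|`
states. -/
theorem conflict_set_nsw_lower_bound (A S : Type) [Fintype S] (B : NGBW A S)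
    (W : Finset (List A)) (hseg : ∀ w ∈ W, GCSeg B w)
    (hconf : ∀ w₁ ∈ W, ∀ w₂ ∈ W, w₁ ≠ w₂ → Conflict B w₁ w₂)
    (T : Type) [Fintype T] (C : NSW A T) (hC : C.Lang = B.Langᶜ) :
    W.card ≤ Fintype.card T := by
  classical
  rcases W.eq_empty_or_nonempty with h | ⟨x₀, hx₀⟩
  · simp [h]
  have key : ∀ w : List A, ∃ (α : ℕ → A) (q : T) (k₀ k₁ : ℕ) (ρ : ℕ → T), w ∈ W →
      (0 < w.length ∧ ∀ n, some (α n) = w[n % w.length]?) ∧ 0 < k₀ ∧ 0 < k₁ ∧ ρ 0 ∈ C.I ∧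
      (∀ i, C.Δ (ρ i) (α i) (ρ (i + 1))) ∧ ρ (k₀ * w.length) = q ∧
      ρ (k₀ * w.length + k₁ * w.length) = q ∧
      ∀ i, (∃ m < k₁ * w.length, ρ (k₀ * w.length + m) ∈ (C.acc i).2) →
        (∃ m < k₁ * w.length, ρ (k₀ * w.length + m) ∈ (C.acc i).1) := by
    have key' : ∀ w ∈ W, ∃ (α : ℕ → A) (q : T) (k₀ k₁ : ℕ) (ρ : ℕ → T),
      (0 < w.length ∧ ∀ n, some (α n) = w[n % w.length]?) ∧ 0 < k₀ ∧ 0 < k₁ ∧ ρ 0 ∈ C.I ∧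
      (∀ i, C.Δ (ρ i) (α i) (ρ (i + 1))) ∧ ρ (k₀ * w.length) = q ∧
      ρ (k₀ * w.length + k₁ * w.length) = q ∧
      ∀ i, (∃ m < k₁ * w.length, ρ (k₀ * w.length + m) ∈ (C.acc i).2) →
        (∃ m < k₁ * w.length, ρ (k₀ * w.length + m) ∈ (C.acc i).1) := by
      intro w hw
      obtain ⟨hne, hw2⟩ := hseg w hw
      have hL : 0 < w.length := List.length_pos_iff.mpr hne
      let α : ℕ → A := fun n => w[n % w.length]'(Nat.mod_lt _ hL)
      have hα : ∀ n, some (α n) = w[n % w.length]? := fun n =>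
        (List.getElem?_eq_getElem (Nat.mod_lt _ hL)).symm
      have hmem : α ∈ C.Lang := by
        rw [hC]
        apply hw2
        refine ⟨fun i h => absurd h (by simp), ?_⟩
        intro i j h
        apply Option.some_injective
        rw [hα, List.get_eq_getElem, ← List.getElem?_eq_getElem]
        congr 1
        simp only [List.length_nil, Nat.zero_add]
        rw [Nat.add_comm, Nat.add_mul_mod_self_right, Nat.mod_eq_of_lt h]
      obtain ⟨q, k₀, k₁, ρ, h⟩ := seg_data C w.length hL α hmem
      exact ⟨α, q, k₀, k₁, ρ, ⟨hL, hα⟩, h⟩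
    intro w
    by_cases hw : w ∈ W
    · obtain ⟨α, q, k₀, k₁, ρ, h⟩ := key' w hw
      exact ⟨α, q, k₀, k₁, ρ, fun _ => h⟩
    · obtain ⟨α, q, k₀, k₁, ρ, h⟩ := key' x₀ hx₀
      exact ⟨α, q, k₀, k₁, ρ, fun h => absurd h hw⟩
  choose α q k₀ k₁ ρ H using key
  rw [← Finset.card_univ]
  refine Finset.card_le_card_of_injOn q (fun _ _ => Finset.mem_coe.mpr (Finset.mem_univ _)) ?_
  intro w hw x hx hq
  by_contra hne
  obtain ⟨⟨hLw, hαw⟩, a1, a2, a3, a4, a5, a6, a7⟩ := H w hw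
  obtain ⟨⟨hLx, hαx⟩, b1, b2, b3, b4, b5, b6, b7⟩ := H x hx
  have hpos := Nat.mul_pos a2 hLw
  have hin := hconf w hw x hx hne (k₀ w) (k₁ w) (k₁ x) a1 a2 b2 _
    (comb_word w x (k₀ w) (k₁ w) (k₀ x) (k₁ x) (α w) (α x) hαw hαx hpos)
  have hin2 := comb_run C (k₀ w * w.length) (k₀ x * x.length) (k₁ w * w.length)
    (k₁ x * x.length) hpos (Nat.mul_pos b2 hLx) (α w) (α x) (ρ w) (ρ x) a3 a4 b4 (q w)
    a5 a6 (b5.trans hq.symm) (b6.trans hq.symm) a7 b7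
  rw [hC] at hin2
  exact hin2 hin

end YanPaper
end

section
/- For all n > 1 and 1 < k ≤ C(n−1, ⌊(n−1)/2⌋), and for every PGCL-ranking ⟨f, g⟩ for FB_{n,k}, there exists an ⟨f, g⟩-segment for FB_{n,k}, i.e., a nonempty finite word w ∈ Σ_n* satisfying properties (Q0), (Q1), (Q2) and (Q3). -/
namespace YanPaper

section Helpers

variable {T ι : Type}

/-- Runs, recursively. -/
def Rn {S : Type} : List (Set (S × S)) → S → S → List S → Prop
  | [], x, y, ρ => x = y ∧ ρ = [x]
  | a :: w, x, y, ρ => ∃ z ρ', (x, z) ∈ a ∧ Rn w z y ρ' ∧ ρ = x :: ρ'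

theorem rn_head {S : Type} (w : List (Set (S × S))) (x y : S) (ρ : List S)
    (h : Rn w x y ρ) : ∃ τ, ρ = x :: τ := by
  cases w with
  | nil => exact ⟨[], h.2⟩
  | cons a w => obtain ⟨z, ρ', _, _, h⟩ := h; exact ⟨ρ', h⟩

theorem rn_last {S : Type} (w : List (Set (S × S))) (x y : S) (ρ : List S)
    (h : Rn w x y ρ) : y ∈ ρ := by
  induction w generalizing x ρ with
  | nil => obtain ⟨rfl, rfl⟩ := h; simp
  | cons a w ih => obtain ⟨z, ρ', _, h1, rfl⟩ := h; exact List.mem_cons_of_mem _ (ih _ _ h1)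

theorem runFromTo_iff {S : Type} (w : List (Set (S × S))) (x y : S) (ρ : List S) :
    RunFromTo (fun p a q => (p, q) ∈ a) w x y ρ ↔ Rn w x y ρ := by
  induction w generalizing x ρ with
  | nil =>
    rcases ρ with _ | ⟨s, _ | ⟨t, ρ⟩⟩
    · simp [RunFromTo, RunOn, Rn]
    · simp only [RunFromTo, RunOn, Rn, List.head?_cons, List.getLast?_singleton, Option.some.injEq,
        true_and, List.cons.injEq, and_true]
      constructor
      · rintro ⟨rfl, rfl⟩; simp
      · rintro ⟨rfl, rfl⟩; simp
    · simp [RunFromTo, RunOn, Rn]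
  | cons a w ih =>
    rcases ρ with _ | ⟨s, _ | ⟨t, ρ⟩⟩
    · simp [RunFromTo, RunOn, Rn]
    · simp only [RunFromTo, RunOn, Rn, false_and, false_iff]
      rintro ⟨z, ρ', _, h, he⟩
      obtain ⟨τ, rfl⟩ := rn_head _ _ _ _ h
      simp at he
    · simp only [Rn]
      constructor
      · rintro ⟨⟨h1, h2⟩, h3, h4⟩
        simp only [List.head?_cons, Option.some.injEq] at h3
        subst h3
        refine ⟨t, t :: ρ, h1, (ih _ _).1 ⟨h2, by simp, ?_⟩, rfl⟩
        simpa [List.getLast?_cons_cons] using h4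
      · rintro ⟨z, ρ', h1, h2, he⟩
        simp only [List.cons.injEq] at he
        obtain ⟨rfl, rfl⟩ := he
        obtain ⟨h3, h4, h5⟩ := (ih _ _).2 h2
        simp only [List.head?_cons, Option.some.injEq] at h4
        subst h4
        refine ⟨⟨h1, h3⟩, by simp, ?_⟩
        simpa [List.getLast?_cons_cons] using h5

theorem rn_append {S : Type} (w v : List (Set (S × S))) (x y : S) (ρ : List S) :
    Rn (w ++ v) x y ρ ↔ ∃ z ρ₁ ρ₂, Rn w x z ρ₁ ∧ Rn v z y ρ₂ ∧ ρ = ρ₁ ++ ρ₂.tail := by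
  induction w generalizing x ρ with
  | nil =>
    constructor
    · intro h
      obtain ⟨τ, rfl⟩ := rn_head _ _ _ _ h
      exact ⟨x, [x], _, ⟨rfl, rfl⟩, h, rfl⟩
    · rintro ⟨z, ρ₁, ρ₂, ⟨rfl, rfl⟩, h, rfl⟩
      obtain ⟨τ, rfl⟩ := rn_head _ _ _ _ h
      exact h
  | cons a w ih =>
    constructor
    · rintro ⟨z, ρ', h1, h2, rfl⟩
      obtain ⟨u, ρ₁, ρ₂, h3, h4, rfl⟩ := (ih _ _).1 h2
      exact ⟨u, x :: ρ₁, ρ₂, ⟨z, ρ₁, h1, h3, rfl⟩, h4, rfl⟩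
    · rintro ⟨u, ρ₁, ρ₂, ⟨z, ρ', h1, h2, rfl⟩, h4, rfl⟩
      exact ⟨z, ρ' ++ ρ₂.tail, h1, (ih _ _).2 ⟨u, ρ', ρ₂, h2, h4, rfl⟩, rfl⟩

theorem mem_join {S : Type} (w v : List (Set (S × S))) (x y z : S) (ρ₁ ρ₂ : List S)
    (h1 : Rn w x z ρ₁) (h2 : Rn v z y ρ₂) (s : S) :
    s ∈ ρ₁ ++ ρ₂.tail ↔ s ∈ ρ₁ ∨ s ∈ ρ₂ := by
  obtain ⟨τ, rfl⟩ := rn_head _ _ _ _ h2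
  have := rn_last _ _ _ _ h1
  simp only [List.tail_cons, List.mem_append, List.mem_cons]
  constructor
  · tauto
  · rintro (h | rfl | h) <;> tauto

/-- Behaviour of a word. -/
structure Spec (F : ι → Finset T) (g : T → ι) (w : List (Set (Option T × Option T)))
    (E D : T → T → Prop) : Prop where
  main : ∀ x y ρ, Rn w x y ρ → ∃ p q, x = some p ∧ y = some q ∧ E p q
  ex : ∀ p q, E p q → ∃ ρ, Rn w (some p) (some q) ρ
  uniq : ∀ x y ρ ρ', Rn w x y ρ → Rn w x y ρ' → ρ = ρ'
  avoid : ∀ p ρ, Rn w (some p) (some p) ρ → ∀ t, some t ∈ ρ → t ∉ F (g p)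
  vis : ∀ p r ρ, D p r → Rn w (some p) (some p) ρ → some r ∈ ρ
  full : ∀ p q ρ, p ≠ q → Rn w (some p) (some q) ρ → ∀ t : T, some t ∈ ρ

theorem Spec.comp {F : ι → Finset T} {g : T → ι} {w v : List (Set (Option T × Option T))}
    {E₁ D₁ E₂ D₂ E D : T → T → Prop} (h₁ : Spec F g w E₁ D₁) (h₂ : Spec F g v E₂ D₂)
    (r₁ : ∀ p, E₁ p p) (r₂ : ∀ p, E₂ p p)
    (ha : ∀ p r q, E₁ p r → E₂ r q → p = r ∨ r = q)
    (hb : ∀ p q, E₁ p q → E₂ p q → p = q)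
    (hE : ∀ p q, E p q ↔ E₁ p q ∨ E₂ p q) (hD : ∀ p q, D p q → D₁ p q ∨ D₂ p q) :
    Spec F g (w ++ v) E D := by
  have key : ∀ x y ρ, Rn (w ++ v) x y ρ → ∃ p r q ρ₁ ρ₂, x = some p ∧ y = some q ∧
      E₁ p r ∧ E₂ r q ∧ Rn w (some p) (some r) ρ₁ ∧ Rn v (some r) (some q) ρ₂ ∧
      ρ = ρ₁ ++ ρ₂.tail := by
    intro x y ρ h
    obtain ⟨z, ρ₁, ρ₂, h3, h4, rfl⟩ := (rn_append _ _ _ _ _).1 h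
    obtain ⟨p, r, rfl, rfl, e1⟩ := h₁.main _ _ _ h3
    obtain ⟨r', q, hr, rfl, e2⟩ := h₂.main _ _ _ h4
    cases hr
    exact ⟨p, r, q, ρ₁, ρ₂, rfl, rfl, e1, e2, h3, h4, rfl⟩
  have loop : ∀ p ρ, Rn (w ++ v) (some p) (some p) ρ → ∃ ρ₁ ρ₂,
      Rn w (some p) (some p) ρ₁ ∧ Rn v (some p) (some p) ρ₂ ∧ ρ = ρ₁ ++ ρ₂.tail := by
    intro p ρ h
    obtain ⟨p', r, q', ρ₁, ρ₂, hp, hq, e1, e2, h3, h4, rfl⟩ := key _ _ _ h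
    cases hp; cases hq
    have : p = r := by rcases ha _ _ _ e1 e2 with h | h <;> simp [h]
    subst this
    exact ⟨_, _, h3, h4, rfl⟩
  refine ⟨?_, ?_, ?_, ?_, ?_, ?_⟩
  · intro x y ρ h
    obtain ⟨p, r, q, ρ₁, ρ₂, rfl, rfl, e1, e2, h3, h4, rfl⟩ := key _ _ _ h
    refine ⟨p, q, rfl, rfl, (hE _ _).2 ?_⟩
    rcases ha _ _ _ e1 e2 with rfl | rfl
    · exact Or.inr e2
    · exact Or.inl e1
  · intro p q h
    have : ∃ r, E₁ p r ∧ E₂ r q := by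
      rcases (hE _ _).1 h with h | h
      · exact ⟨q, h, r₂ q⟩
      · exact ⟨p, r₁ p, h⟩
    obtain ⟨r, e1, e2⟩ := this
    obtain ⟨ρ₁, h3⟩ := h₁.ex _ _ e1
    obtain ⟨ρ₂, h4⟩ := h₂.ex _ _ e2
    exact ⟨_, (rn_append _ _ _ _ _).2 ⟨_, _, _, h3, h4, rfl⟩⟩
  · intro x y ρ ρ' h h'
    obtain ⟨p, r, q, ρ₁, ρ₂, rfl, rfl, e1, e2, h3, h4, rfl⟩ := key _ _ _ h
    obtain ⟨p', r', q', σ₁, σ₂, hp, hq, e1', e2', h3', h4', rfl⟩ := key _ _ _ h'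
    cases hp; cases hq
    have : r = r' := by
      rcases ha _ _ _ e1 e2 with rfl | rfl <;> rcases ha _ _ _ e1' e2' with rfl | rfl
      · rfl
      · exact hb _ _ e1' e2
      · exact (hb _ _ e1 e2').symm
      · rfl
    subst this
    rw [h₁.uniq _ _ _ _ h3 h3', h₂.uniq _ _ _ _ h4 h4']
  · intro p ρ h t ht
    obtain ⟨ρ₁, ρ₂, h3, h4, rfl⟩ := loop _ _ h
    rcases (mem_join _ _ _ _ _ _ _ h3 h4 _).1 ht with ht | ht
    · exact h₁.avoid _ _ h3 _ ht
    · exact h₂.avoid _ _ h4 _ ht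
  · intro p r ρ hd h
    obtain ⟨ρ₁, ρ₂, h3, h4, rfl⟩ := loop _ _ h
    rw [mem_join _ _ _ _ _ _ _ h3 h4]
    rcases hD _ _ hd with hd | hd
    · exact Or.inl (h₁.vis _ _ _ hd h3)
    · exact Or.inr (h₂.vis _ _ _ hd h4)
  · intro p q ρ hpq h t
    obtain ⟨p', r, q', ρ₁, ρ₂, hp, hq, e1, e2, h3, h4, rfl⟩ := key _ _ _ h
    cases hp; cases hq
    rw [mem_join _ _ _ _ _ _ _ h3 h4]
    by_cases hr : p = r
    · subst hr
      exact Or.inr (h₂.full _ _ _ hpq h4 t)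
    · exact Or.inl (h₁.full _ _ _ hr h3 t)

/-- Words moving along an injection and back. -/
theorem spec_move (F : ι → Finset T) (g : T → ι) (hg : ∀ q, q ∉ F (g q)) (σ : T → Option T)
    (hσ : Function.Injective σ) (hav : ∀ s t, σ s = some t → t ∉ F (g s)) :
    ∃ w, Spec F g w (fun p q => p = q) (fun p r => σ p = some r) := by
  have key : ∀ x y ρ, Rn [{z | ∃ s, z = (some s, σ s)}, {z | ∃ s, z = (σ s, some s)}] x y ρ ↔
      ∃ s, x = some s ∧ y = some s ∧ ρ = [some s, σ s, some s] := by
    intro x y ρ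
    simp only [Rn, Set.mem_ofPred_eq, Prod.mk.injEq]
    constructor
    · rintro ⟨z, ρ', ⟨s, rfl, rfl⟩, ⟨z', ρ'', ⟨s', h1, rfl⟩, ⟨rfl, rfl⟩, rfl⟩, rfl⟩
      cases hσ h1
      exact ⟨s, rfl, rfl, rfl⟩
    · rintro ⟨s, rfl, rfl, rfl⟩
      exact ⟨σ s, _, ⟨s, rfl, rfl⟩, ⟨some s, _, ⟨s, rfl, rfl⟩, ⟨rfl, rfl⟩, rfl⟩, rfl⟩
  refine ⟨[{z | ∃ s, z = (some s, σ s)}, {z | ∃ s, z = (σ s, some s)}],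
    ⟨?_, ?_, ?_, ?_, ?_, ?_⟩⟩
  · intro x y ρ h
    obtain ⟨s, rfl, rfl, rfl⟩ := (key _ _ _).1 h
    exact ⟨s, s, rfl, rfl, rfl⟩
  · rintro p q rfl
    exact ⟨_, (key _ _ _).2 ⟨p, rfl, rfl, rfl⟩⟩
  · intro x y ρ ρ' h h'
    obtain ⟨s, rfl, rfl, rfl⟩ := (key _ _ _).1 h
    obtain ⟨s', hs, -, rfl⟩ := (key _ _ _).1 h'
    cases hs; rfl
  · intro p ρ h t ht
    obtain ⟨s, hs, -, rfl⟩ := (key _ _ _).1 h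
    cases hs
    simp only [List.mem_cons, Option.some.injEq, List.not_mem_nil, or_false] at ht
    rcases ht with rfl | ht | rfl
    · exact hg _
    · exact hav _ _ ht.symm
    · exact hg _
  · intro p r ρ hd h
    obtain ⟨s, hs, -, rfl⟩ := (key _ _ _).1 h
    cases hs
    simp [hd]
  · intro p q ρ hpq h
    obtain ⟨s, hs, hs', -⟩ := (key _ _ _).1 h
    cases hs; cases hs'
    exact absurd rfl hpq

variable [DecidableEq T]

theorem spec_visits (F : ι → Finset T) (g : T → ι) (hg : ∀ q, q ∉ F (g q))
    (A : Finset (T × T)) (hA : ∀ z ∈ A, z.2 ∉ F (g z.1)) :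
    ∃ w, Spec F g w (fun p q => p = q) (fun p r => (p, r) ∈ A) := by
  induction A using Finset.induction_on with
  | empty =>
    obtain ⟨w, hw⟩ := spec_move F g hg some (Option.some_injective _)
      (by intro s t h; cases h; exact hg _)
    exact ⟨w, hw.main, hw.ex, hw.uniq, hw.avoid, by simp, hw.full⟩
  | insert z A hz ih =>
    obtain ⟨w, hw⟩ := ih (fun z hz => hA z (Finset.mem_insert_of_mem hz))
    have hz2 := hA z (Finset.mem_insert_self _ _)
    obtain ⟨p, r⟩ := z
    obtain ⟨v, hv⟩ := spec_move F g hg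
      (fun s => if s = p then some r else if s = r then none else some s)
      (by
        intro a b hab
        grind)
      (by
        intro s t h
        by_cases h1 : s = p
        · simp only [h1, if_true, Option.some.injEq] at h
          subst h; subst h1; exact hz2
        · by_cases h2 : s = r
          · subst h2
            simp [h1] at h
          · simp [h1, h2] at h
            subst h; exact hg _)
    refine ⟨w ++ v, hw.comp hv (fun _ => rfl) (fun _ => rfl) ?_ ?_ ?_ ?_⟩
    · intro p r q h _; exact Or.inl h
    · intro p q h _; exact h
    · intro p q; simp
    · intro p' q' h
      rcases Finset.mem_insert.1 h with h | h
      · right; cases h; simp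
      · exact Or.inl h

/-- middle word -/
def midW (l : List T) : List (Set (Option T × Option T)) :=
  l.flatMap (fun r => [{z | z.2 = Equiv.swap none (some r) z.1},
    {z | z.2 = Equiv.swap none (some r) z.1}])

theorem rn_mid (l : List T) (w : List (Set (Option T × Option T))) (x y : Option T)
    (ρ : List (Option T)) : Rn (midW l ++ w) x y ρ ↔
      ∃ ρ', Rn w x y ρ' ∧ ρ = l.flatMap (fun r => [x, Equiv.swap none (some r) x]) ++ ρ' := by
  induction l generalizing ρ with
  | nil => simp [midW]
  | cons r l ih =>
    have : midW (r :: l) ++ w = {z | z.2 = Equiv.swap none (some r) z.1} ::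
      {z | z.2 = Equiv.swap none (some r) z.1} :: (midW l ++ w) := by simp [midW]
    rw [this]
    simp only [Rn, Set.mem_ofPred_eq]
    constructor
    · rintro ⟨z, ρ', rfl, ⟨z', ρ'', rfl, h, rfl⟩, rfl⟩
      rw [Equiv.swap_apply_self] at h
      obtain ⟨τ, h', rfl⟩ := (ih _).1 h
      exact ⟨τ, h', by simp⟩
    · rintro ⟨τ, h, rfl⟩
      refine ⟨_, _, rfl, ⟨_, l.flatMap (fun r => [x, Equiv.swap none (some r) x]) ++ τ, rfl, ?_,
        rfl⟩, ?_⟩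
      · rw [Equiv.swap_apply_self]
        exact (ih _).2 ⟨τ, h, rfl⟩
      · simp

theorem spec_branch [Fintype T] (F : ι → Finset T) (g : T → ι) (hg : ∀ q, q ∉ F (g q))
    (p q : T) (hpq : p ≠ q) :
    ∃ w, Spec F g w (fun s t => s = t ∨ (s = p ∧ t = q)) (fun _ _ => False) := by
  let l : List T := Finset.univ.toList
  have hl : ∀ t, t ∈ l := by intro t; simp [l]
  let P : Option T → List (Option T) :=
    fun x => l.flatMap (fun r => [x, Equiv.swap none (some r) x])
  let a : Set (Option T × Option T) :=
    {z | ∃ s, z = (some s, some s) ∨ (s = p ∧ z = (some s, none))}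
  let b : Set (Option T × Option T) :=
    {z | ∃ s, z = (some s, some s) ∨ (s = q ∧ z = (none, some s))}
  have key : ∀ x y ρ, Rn (a :: (midW l ++ [b])) x y ρ ↔
      (∃ s, x = some s ∧ y = some s ∧ ρ = some s :: (P (some s) ++ [some s, some s])) ∨
      (x = some p ∧ y = some q ∧ ρ = some p :: (P none ++ [none, some q])) := by
    intro x y ρ
    simp only [Rn, rn_mid]
    constructor
    · rintro ⟨z, _, ⟨s, ha⟩, ⟨_, ⟨z', _, ⟨s', hb⟩, ⟨rfl, rfl⟩, rfl⟩, rfl⟩, rfl⟩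
      rcases ha with ha | ⟨rfl, ha⟩ <;> rcases hb with hb | ⟨rfl, hb⟩ <;>
        simp only [Prod.mk.injEq] at ha hb <;> obtain ⟨rfl, rfl⟩ := ha <;>
        obtain ⟨hb, rfl⟩ := hb
      · cases hb; left; exact ⟨s, rfl, rfl, rfl⟩
      · cases hb
      · cases hb
      · right; exact ⟨rfl, rfl, rfl⟩
    · rintro (⟨s, rfl, rfl, rfl⟩ | ⟨rfl, rfl, rfl⟩)
      · exact ⟨some s, _, ⟨s, Or.inl rfl⟩, ⟨_, ⟨some s, _, ⟨s, Or.inl rfl⟩, ⟨rfl, rfl⟩, rfl⟩, rfl⟩, rfl⟩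
      · exact ⟨none, _, ⟨p, Or.inr ⟨rfl, rfl⟩⟩,
          ⟨_, ⟨some q, _, ⟨q, Or.inr ⟨rfl, rfl⟩⟩, ⟨rfl, rfl⟩, rfl⟩, rfl⟩, rfl⟩
  refine ⟨a :: (midW l ++ [b]), ⟨?_, ?_, ?_, ?_, ?_, ?_⟩⟩
  · intro x y ρ h
    rcases (key _ _ _).1 h with ⟨s, rfl, rfl, -⟩ | ⟨rfl, rfl, -⟩
    · exact ⟨s, s, rfl, rfl, Or.inl rfl⟩
    · exact ⟨p, q, rfl, rfl, Or.inr ⟨rfl, rfl⟩⟩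
  · rintro s t (rfl | ⟨rfl, rfl⟩)
    · exact ⟨_, (key _ _ _).2 (Or.inl ⟨s, rfl, rfl, rfl⟩)⟩
    · exact ⟨_, (key _ _ _).2 (Or.inr ⟨rfl, rfl, rfl⟩)⟩
  · intro x y ρ ρ' h h'
    rcases (key _ _ _).1 h with ⟨s, rfl, rfl, rfl⟩ | ⟨rfl, rfl, rfl⟩ <;>
    rcases (key _ _ _).1 h' with ⟨s', h1, h2, rfl⟩ | ⟨h1, h2, rfl⟩
    · cases h1; rfl
    · cases h1; cases h2; exact absurd rfl hpq
    · cases h1; cases h2; exact absurd rfl hpq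
    · rfl
  · intro s ρ h t ht
    rcases (key _ _ _).1 h with ⟨s', h1, -, rfl⟩ | ⟨h1, h2, rfl⟩
    · cases h1
      have : t = s := by
        simp only [P, List.mem_cons, List.mem_append, List.mem_flatMap, Option.some.injEq,
          List.not_mem_nil, or_false] at ht
        rcases ht with ht | ⟨r, -, ht | ht⟩ | ht | ht
        · exact ht
        · exact ht
        · by_cases hr : s = r
          · subst hr; simp at ht
          · rw [Equiv.swap_apply_of_ne_of_ne (by simp) (by simpa using hr)] at ht
            simpa using ht
        · exact ht
        · exact ht
      subst this; exact hg _
    · cases h1; cases h2; exact absurd rfl hpq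
  · intro _ _ _ h; exact h.elim
  · intro s t ρ hst h u
    rcases (key _ _ _).1 h with ⟨s', h1, h2, rfl⟩ | ⟨h1, h2, rfl⟩
    · cases h1; cases h2; exact absurd rfl hst
    · simp only [P, List.mem_cons, List.mem_append, List.mem_flatMap]
      right; left
      exact ⟨u, hl u, by simp⟩

theorem spec_all [Fintype T] (F : ι → Finset T) (g : T → ι) (hg : ∀ q, q ∉ F (g q))
    (f : T → ℕ) (hf : Function.Injective f) (n : ℕ) (hn : ∀ p, f p < n) (D : T → T → Prop)
    (w₀ : List (Set (Option T × Option T))) (h₀ : Spec F g w₀ (fun p q => p = q) D) (N : ℕ) :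
    ∃ w, Spec F g w (fun p q => p = q ∨ (f q < f p ∧ f p * n + f q < N)) D := by
  induction N with
  | zero => exact ⟨w₀, by simpa using h₀⟩
  | succ N ih =>
    obtain ⟨w, hw⟩ := ih
    by_cases hex : ∃ p q, f q < f p ∧ f p * n + f q = N
    · obtain ⟨p, q, hlt, rfl⟩ := hex
      have hpq : p ≠ q := by rintro rfl; omega
      obtain ⟨v, hv⟩ := spec_branch F g hg p q hpq
      refine ⟨w ++ v, hw.comp hv (fun _ => Or.inl rfl) (fun _ => Or.inl rfl) ?_ ?_ ?_ ?_⟩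
      · rintro s r t h1 (rfl | ⟨rfl, rfl⟩)
        · exact Or.inr rfl
        · rcases h1 with rfl | ⟨h1, h2⟩
          · exact Or.inl rfl
          · exfalso
            have := hn t
            nlinarith
      · rintro s t (rfl | ⟨h1, h2⟩) (h3 | ⟨rfl, rfl⟩)
        · rfl
        · rfl
        · exact h3
        · omega
      · intro s t
        constructor
        · rintro (rfl | ⟨h1, h2⟩)
          · exact Or.inl (Or.inl rfl)
          · rcases Nat.lt_succ_iff_lt_or_eq.1 h2 with h2 | h2
            · exact Or.inl (Or.inr ⟨h1, h2⟩)
            · right; right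
              have ht := hn t
              have hq := hn q
              have e1 : f s = f p := by
                rcases lt_trichotomy (f s) (f p) with h | h | h
                · exfalso; nlinarith
                · exact h
                · exfalso; nlinarith
              rw [e1] at h2
              exact ⟨hf e1, hf (by omega)⟩
        · rintro ((rfl | ⟨h1, h2⟩) | (rfl | ⟨rfl, rfl⟩))
          · exact Or.inl rfl
          · exact Or.inr ⟨h1, by omega⟩
          · exact Or.inl rfl
          · exact Or.inr ⟨hlt, by omega⟩
      · intro _ _ h; exact Or.inl h
    · have : (fun p q => p = q ∨ (f q < f p ∧ f p * n + f q < N + 1)) =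
          (fun p q => p = q ∨ (f q < f p ∧ f p * n + f q < N)) := by
        funext p q
        apply propext
        constructor
        · rintro (h | ⟨h1, h2⟩)
          · exact Or.inl h
          · refine Or.inr ⟨h1, ?_⟩
            have : f p * n + f q ≠ N := fun h => hex ⟨p, q, h1, h⟩
            omega
        · rintro (h | ⟨h1, h2⟩)
          · exact Or.inl h
          · exact Or.inr ⟨h1, by omega⟩
      rw [this]
      exact ⟨w, hw⟩

end Helpers

/-- for every PGCL-ranking `⟨f, g⟩` for `FB (n,k)` there exists an
`⟨f, g⟩`-segment. -/
theorem exists_pgcl_segment (n k : ℕ) (hn : 1 < n) (hk1 : 1 < k)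
    (hk2 : k ≤ (n - 1).choose ((n - 1) / 2))
    (F : Fin k → Finset (Fin (n - 1))) (hF : GoodAcc n k F)
    (f : Fin (n - 1) → ℕ) (g : Fin (n - 1) → Fin k) (hfg : PGCL n k F f g) :
    ∃ w : List (FBAlpha n), IsSegGen n k F f g w := by
  classical
  obtain ⟨hinj, hcard, -⟩ := hF
  obtain ⟨hfr, hfi, -, hg⟩ := hfg
  have hpos : 1 ≤ (n - 1) / 2 := by
    by_contra hlt
    have h0 : (n - 1) / 2 = 0 := by omega
    rw [h0] at hk2
    simp at hk2
    omega
  obtain ⟨w₀, h₀⟩ := spec_visits F g hg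
    (Finset.univ.filter (fun z : Fin (n - 1) × Fin (n - 1) => z.2 ∉ F (g z.1)))
    (by intro z hz; exact (Finset.mem_filter.1 hz).2)
  obtain ⟨w, hw⟩ := spec_all F g hg f hfi n (fun p => by have := hfr p; omega) _ w₀ h₀ (n * n + n)
  have hE : ∀ p q, f q < f p → f p * n + f q < n * n + n := by
    intro p q _
    have h1 := (hfr p).2
    have h2 := (hfr q).2
    have h3 : f p * n ≤ n * n := Nat.mul_le_mul_right _ (by omega)
    omega
  have hrun : ∀ x y ρ, RunFromTo (FBgen n k F).Δ w x y ρ ↔ Rn w x y ρ :=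
    fun x y ρ => runFromTo_iff w x y ρ
  refine ⟨w, ?_, ?_, ?_, ?_, ?_⟩
  · rintro rfl
    obtain ⟨p, q, h, -⟩ := hw.main none none [none] ⟨rfl, rfl⟩
    cases h
  · intro ρ x h1 h2
    cases ρ with
    | nil => simp at h2
    | cons y ρ =>
      obtain ⟨p, q, -, rfl, -⟩ := hw.main y x (y :: ρ) ((hrun _ _ _).1 ⟨h1, rfl, h2⟩)
      simp
  · intro p
    simp only [hrun]
    refine ⟨?_, ?_⟩
    · obtain ⟨ρ, h⟩ := hw.ex p p (Or.inl rfl)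
      exact ⟨ρ, h, fun ρ' h' => hw.uniq _ _ _ _ h' h⟩
    · intro ρ h
      refine ⟨?_, ?_⟩
      · intro i hi
        have : ∃ q ∈ F i, q ∉ F (g p) := by
          by_contra hcon
          push Not at hcon
          exact hi (hinj (Finset.eq_of_subset_of_card_le hcon (by rw [hcard, hcard])))
        obtain ⟨q, hq1, hq2⟩ := this
        exact ⟨some q, hw.vis p q ρ (by simpa using hq2) h, q, hq1, rfl⟩
      · rintro s hs q hq rfl
        exact hw.avoid p ρ h q hs hq
  · intro p q hpq
    simp only [hrun]
    refine ⟨?_, ?_⟩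
    · obtain ⟨ρ, h⟩ := hw.ex p q (Or.inr ⟨hpq, hE p q hpq⟩)
      exact ⟨ρ, h, fun ρ' h' => hw.uniq _ _ _ _ h' h⟩
    · intro ρ h i
      have : (F i).Nonempty := by
        rw [← Finset.card_pos, hcard]; omega
      obtain ⟨r, hr⟩ := this
      exact ⟨some r, hw.full p q ρ (by rintro rfl; omega) h r, r, hr, rfl⟩
  · rintro p q hpq ⟨ρ, h⟩
    rw [hrun] at h
    obtain ⟨p', q', h1, h2, h3⟩ := hw.main _ _ _ h
    cases h1; cases h2
    rcases h3 with rfl | ⟨h3, -⟩ <;> omega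

end YanPaper
end

section
/- Let n > 1 and 1 < k ≤ C(n−1, ⌊(n−1)/2⌋), and suppose that for every PGCL-ranking ⟨f, g⟩ for FB_{n,k}, seg_{f,g} is an ⟨f, g⟩-segment for FB_{n,k}. Then: (a) each seg_{f,g} is a GC-segment of FB_{n,k}, i.e., (seg_{f,g})^ω ∉ L(FB_{n,k}); (b) for any two distinct PGCL-rankings ⟨f_1, g_1⟩ ≠ ⟨f_2, g_2⟩, writing w_1 = seg_{f_1,g_1} and w_2 = seg_{f_2,g_2}, every ω-word of the form w_1^{k_0} (w_1^{k_1} w_2^{k_2})^ω with k_0, k_1, k_2 > 0 belongs to L(FB_{n,k}) (in particular w_1 ≠ w_2); (c) the number of PGCL-rankings for FB_{n,k} is at least (n−1)! · ⌊k/2⌋^{n−1}. Consequently {seg_{f,g} : ⟨f, g⟩ a PGCL-ranking} is a conflict set for FB_{n,k} of cardinality at least (n−1)! · ⌊k/2⌋^{n−1}. -/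
namespace YanPaper

/-- functional form of a finite run -/
def PathFn {S A : Type*} (Δ : S → A → S → Prop) (w : List A) (p q : S) (σ : ℕ → S) : Prop :=
  σ 0 = p ∧ σ w.length = q ∧ ∀ i (h : i < w.length), Δ (σ i) w[i] (σ (i + 1))

theorem path_of_run {S A : Type*} {Δ : S → A → S → Prop} : ∀ (w : List A) (p q : S) (ρ : List S),
    RunFromTo Δ w p q ρ →
    ∃ σ, PathFn Δ w p q σ ∧ ∀ s, s ∈ ρ ↔ ∃ t, t ≤ w.length ∧ σ t = s := by
  intro w
  induction w with
  | nil =>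
    rintro p q ρ ⟨h, h1, h2⟩
    match ρ, h, h1, h2 with
    | [x], _, h1, h2 =>
      simp at h1 h2
      subst h1; subst h2
      refine ⟨fun _ => x, ⟨rfl, rfl, by simp⟩, ?_⟩
      intro s
      simp [eq_comm]
    | x :: y :: ρ, h, _, _ => simp [RunOn] at h
  | cons a w ih =>
    rintro p q ρ ⟨h, h1, h2⟩
    match ρ, h, h1, h2 with
    | [x], h, _, _ => simp [RunOn] at h
    | x :: y :: ρ, h, h1, h2 =>
      simp only [RunOn] at h
      simp at h1
      subst h1
      obtain ⟨σ, ⟨s0, s1, s2⟩, hσ⟩ := ih y q (y :: ρ) ⟨h.2, rfl, by simpa using h2⟩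
      refine ⟨fun t => Nat.casesOn t x (fun t => σ t), ⟨rfl, s1, ?_⟩, ?_⟩
      · intro i hi
        cases i with
        | zero => simpa [s0] using h.1
        | succ i => simpa using s2 i (by simpa using hi)
      · intro s
        rw [List.mem_cons, hσ]
        constructor
        · rintro (rfl | ⟨t, ht, rfl⟩)
          · exact ⟨0, by simp, rfl⟩
          · exact ⟨t + 1, by simpa using ht, rfl⟩
        · rintro ⟨t, ht, rfl⟩
          cases t with
          | zero => left; rfl
          | succ t => right; exact ⟨t, by simpa using ht, rfl⟩

theorem run_of_path {S A : Type*} {Δ : S → A → S → Prop} : ∀ (w : List A) (p q : S) (σ : ℕ → S),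
    PathFn Δ w p q σ →
    ∃ ρ, RunFromTo Δ w p q ρ ∧ ∀ s, s ∈ ρ ↔ ∃ t, t ≤ w.length ∧ σ t = s := by
  intro w
  induction w with
  | nil =>
    rintro p q σ ⟨h, h1, h2⟩
    refine ⟨[p], ⟨by simp [RunOn], rfl, by simpa [h] using h1⟩, ?_⟩
    intro s
    simp [h, eq_comm]
  | cons a w ih =>
    rintro p q σ ⟨h, h1, h2⟩
    obtain ⟨ρ, ⟨r0, r1, r2⟩, hρ⟩ := ih (σ 1) q (fun t => σ (t + 1))
      ⟨rfl, h1, fun i hi => h2 (i + 1) (by simpa using hi)⟩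
    match ρ, r0, r1, r2, hρ with
    | y :: ρ, r0, r1, r2, hρ =>
      simp at r1
      subst r1
      refine ⟨p :: σ 1 :: ρ, ⟨?_, rfl, by simpa using r2⟩, ?_⟩
      · simp only [RunOn]
        have h3 : Δ (σ 0) a (σ 1) := h2 0 (by simp)
        rw [h] at h3
        exact ⟨h3, r0⟩
      · intro s
        rw [List.mem_cons, hρ]
        constructor
        · rintro (rfl | ⟨t, ht, rfl⟩)
          · exact ⟨0, by simp, h⟩
          · exact ⟨t + 1, by simpa using ht, rfl⟩
        · rintro ⟨t, ht, rfl⟩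
          cases t with
          | zero => left; exact h
          | succ t => right; exact ⟨t, by simpa using ht, rfl⟩

/-- path visiting all sets with index in `J` -/
def VisP {S A ι : Type*} (Δ : S → A → S → Prop) (T : ι → Set S) (w : List A) (p q : S)
    (J : Set ι) : Prop :=
  ∃ σ, PathFn Δ w p q σ ∧ ∀ i ∈ J, ∃ t, t ≤ w.length ∧ σ t ∈ T i

theorem VisP.append {S A ι : Type*} {Δ : S → A → S → Prop} {T : ι → Set S} {u v : List A}
    {p q r : S} {J K : Set ι} (h1 : VisP Δ T u p q J) (h2 : VisP Δ T v q r K) :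
    VisP Δ T (u ++ v) p r (J ∪ K) := by
  obtain ⟨σ, ⟨a0, a1, a2⟩, a3⟩ := h1
  obtain ⟨τ, ⟨b0, b1, b2⟩, b3⟩ := h2
  have hle : ∀ t, t ≤ u.length →
      (if t < u.length then σ t else τ (t - u.length)) = σ t := by
    intro t ht
    split_ifs with h
    · rfl
    · have : t = u.length := by omega
      subst this
      simp [b0, a1]
  have hge : ∀ t, u.length ≤ t →
      (if t < u.length then σ t else τ (t - u.length)) = τ (t - u.length) := by
    intro t ht
    rw [if_neg (by omega)]
  refine ⟨fun t => if t < u.length then σ t else τ (t - u.length), ⟨?_, ?_, ?_⟩, ?_⟩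
  · show (if 0 < u.length then σ 0 else τ (0 - u.length)) = p
    rw [hle 0 (by omega), a0]
  · show (if (u ++ v).length < u.length then σ _ else τ _) = r
    rw [hge _ (by simp), List.length_append, Nat.add_sub_cancel_left, b1]
  · intro i hi
    show Δ (if i < u.length then σ i else τ _) _ (if i + 1 < u.length then σ _ else τ _)
    by_cases h : i < u.length
    · rw [hle i h.le, hle (i + 1) h, List.getElem_append_left h]
      exact a2 i h
    · rw [hge i (by omega), hge (i + 1) (by omega), List.getElem_append_right (by omega)]
      have := b2 (i - u.length) (by simp at hi; omega)
      rwa [show i - u.length + 1 = i + 1 - u.length by omega] at this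
  · rintro i (hi | hi)
    · obtain ⟨t, ht, h⟩ := a3 i hi
      refine ⟨t, by simp; omega, ?_⟩
      show (if t < u.length then σ t else τ (t - u.length)) ∈ _
      rwa [hle t ht]
    · obtain ⟨t, ht, h⟩ := b3 i hi
      refine ⟨u.length + t, by simp; omega, ?_⟩
      show (if u.length + t < u.length then σ _ else τ _) ∈ _
      rwa [hge _ (by omega), Nat.add_sub_cancel_left]

theorem VisP.mono {S A ι : Type*} {Δ : S → A → S → Prop} {T : ι → Set S} {u : List A}
    {p q : S} {J K : Set ι} (h1 : VisP Δ T u p q J) (h : K ⊆ J) : VisP Δ T u p q K := by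
  obtain ⟨σ, a, b⟩ := h1
  exact ⟨σ, a, fun i hi => b i (h hi)⟩

theorem listPow_succ' {A : Type*} (w : List A) (k : ℕ) : listPow w (k + 1) = w ++ listPow w k := by
  simp [listPow, List.replicate_succ]

theorem VisP.pow0 {S A ι : Type*} {Δ : S → A → S → Prop} {T : ι → Set S} {u : List A}
    {p : S} {J : Set ι} (h1 : VisP Δ T u p p J) (k : ℕ) : VisP Δ T (listPow u k) p p ∅ := by
  induction k with
  | zero => exact ⟨fun _ => p, ⟨rfl, rfl, by simp [listPow]⟩, by simp⟩
  | succ k ih =>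
    rw [listPow_succ']
    exact (h1.append ih).mono (by simp)

/-- first step `p → q` then stay at `q` -/
theorem VisP.pow1 {S A ι : Type*} {Δ : S → A → S → Prop} {T : ι → Set S} {u : List A}
    {p q : S} {J K : Set ι} (h1 : VisP Δ T u p q J) (h2 : VisP Δ T u q q K) (k : ℕ) (hk : 0 < k) :
    VisP Δ T (listPow u k) p q J := by
  obtain ⟨k, rfl⟩ := Nat.exists_eq_succ_of_ne_zero hk.ne'
  rw [Nat.succ_eq_add_one, listPow_succ']
  exact (h1.append (h2.pow0 k)).mono (by simp)

theorem omega_acc {A S : Type*} (B : NGBW A S) (u v : List A) (p q : S) (hv : v ≠ [])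
    (hp : p ∈ B.I) (hu : VisP B.Δ B.F u p q ∅) (hvv : VisP B.Δ B.F v q q Set.univ)
    (α : ℕ → A) (hα : IsUVOmega u v α) : α ∈ B.Lang := by
  obtain ⟨σ, ⟨a0, a1, a2⟩, -⟩ := hu
  obtain ⟨τ, ⟨b0, b1, b2⟩, b3⟩ := hvv
  obtain ⟨h1, h2⟩ := hα
  have hL : 0 < v.length := List.length_pos_iff.mpr hv
  set ρ : ℕ → S := fun t => if t < u.length then σ t else τ ((t - u.length) % v.length) with hρ
  have hle : ∀ t, t ≤ u.length → ρ t = σ t := by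
    intro t ht
    simp only [hρ]
    split_ifs with h
    · rfl
    · have : t = u.length := by omega
      subst this
      simp [b0, a1]
  have hge : ∀ i j, j ≤ v.length → ρ (u.length + i * v.length + j) = τ j := by
    intro i j hj
    simp only [hρ]
    rw [if_neg (by omega), show u.length + i * v.length + j - u.length = j + i * v.length by omega,
      Nat.add_mul_mod_self_right]
    rcases hj.lt_or_eq with h | h
    · rw [Nat.mod_eq_of_lt h]
    · subst h
      rw [Nat.mod_self, b0, b1]
  refine ⟨ρ, ?_, ?_, ?_⟩
  · rw [hle 0 (by omega), a0]; exact hp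
  · intro i
    by_cases h : i < u.length
    · rw [hle i h.le, hle (i + 1) h, h1 i h]
      exact a2 i h
    · obtain ⟨a, b, hb, rfl⟩ : ∃ a b, b < v.length ∧ i = u.length + a * v.length + b := by
        refine ⟨(i - u.length) / v.length, (i - u.length) % v.length, Nat.mod_lt _ hL, ?_⟩
        have := Nat.div_add_mod' (i - u.length) v.length
        omega
      rw [h2 a b hb, hge a b hb.le, add_assoc (u.length + _) b 1, hge a (b + 1) hb]
      exact b2 b hb
  · intro i
    obtain ⟨t, ht, h⟩ := b3 i trivial
    refine ⟨τ t, ?_, h⟩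
    intro N
    refine ⟨u.length + N * v.length + t, ?_, hge N t ht⟩
    have := Nat.le_mul_of_pos_right N hL
    omega

theorem ranking_sep (m : ℕ) (f₁ f₂ : Fin m → ℕ)
    (a0 : ∀ p, 1 ≤ f₁ p ∧ f₁ p ≤ m) 
    (a2 : ∀ r, 1 ≤ r → r ≤ m → ∃ p, f₁ p = r)
    (b0 : ∀ p, 1 ≤ f₂ p ∧ f₂ p ≤ m) (b1 : Function.Injective f₂)
    (b2 : ∀ r, 1 ≤ r → r ≤ m → ∃ p, f₂ p = r) (a1 : Function.Injective f₁) (hne : f₁ ≠ f₂) :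
    ∃ p q, f₁ q < f₁ p ∧ f₂ p < f₂ q := by
  by_contra! hc
  apply hne
  have key : ∀ r, ∀ p, f₁ p = r → f₂ p = r := by
    intro r
    induction r using Nat.strong_induction_on with
    | _ r ih =>
      intro p hp
      obtain ⟨q, hq⟩ := b2 r (hp ▸ (a0 p).1) (hp ▸ (a0 p).2)
      rcases lt_trichotomy (f₁ q) r with h | h | h
      · have := ih _ h q rfl
        omega
      · have : q = p := a1 (h.trans hp.symm)
        rw [← this, hq]
      · have h3 := hc q p (by omega)
        rcases h3.lt_or_eq with h4 | h4
        · obtain ⟨p', hp'⟩ := a2 (f₂ p) (b0 p).1 (b0 p).2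
          have := ih _ (by omega) p' hp'
          have := b1 this
          subst this
          omega
        · omega
  funext p
  exact (key _ p rfl).symm

theorem seg_gc (n k : ℕ) (F : Fin k → Finset (Fin (n - 1))) (f : Fin (n - 1) → ℕ)
    (g : Fin (n - 1) → Fin k) (w : List (FBAlpha n)) (hf : Function.Injective f)
    (hw : IsSegGen n k F f g w) : GCSeg (FBgen n k F) w := by
  obtain ⟨w0, q0, q1, q2, q3⟩ := hw
  refine ⟨w0, ?_⟩
  rintro α ⟨-, hα⟩ ⟨ρ, -, hs, hacc⟩
  have hL : 0 < w.length := List.length_pos_iff.mpr w0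
  have hblock : ∀ i, ∃ l, RunFromTo (FBgen n k F).Δ w (ρ (i * w.length)) (ρ ((i + 1) * w.length)) l ∧
      ∀ s, s ∈ l ↔ ∃ t, t ≤ w.length ∧ ρ (i * w.length + t) = s := by
    intro i
    apply run_of_path
    refine ⟨by simp, by simp only []; congr 1; ring, ?_⟩
    intro j hj
    have := hα i j hj
    simp only [List.length_nil, zero_add] at this
    have h2 := hs (i * w.length + j)
    rw [this] at h2
    exact h2
  have hmain : ∀ i, ∃ p, ρ ((i + 1) * w.length) = some p := by
    intro i
    obtain ⟨l, ⟨h1, h2, h3⟩, -⟩ := hblock i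
    exact Option.ne_none_iff_exists'.mp (q0 l _ h1 h3)
  choose P hP using hmain
  have hanti : Antitone (fun i => f (P i)) := by
    apply antitone_nat_of_succ_le
    intro i
    by_contra! h
    obtain ⟨l, hl, -⟩ := hblock (i + 1)
    rw [hP, hP] at hl
    exact q3 _ _ h ⟨l, hl⟩
  obtain ⟨N, hN⟩ : ∃ N, ∀ m, N ≤ m → f (P m) = f (P N) := by
    obtain ⟨N, hN⟩ := WellFounded.has_min (wellFounded_lt (α := ℕ)) (Set.range fun i => f (P i))
      ⟨_, 0, rfl⟩
    obtain ⟨⟨N, rfl⟩, h⟩ := hN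
    exact ⟨N, fun m hm => le_antisymm (hanti hm) (not_lt.mp (h _ ⟨m, rfl⟩))⟩
  have hN' : ∀ m, N ≤ m → P m = P N := fun m hm => hf (hN m hm)
  obtain ⟨s, hs1, hs2⟩ := hacc (g (P N))
  obtain ⟨q, hq, rfl⟩ := hs2
  obtain ⟨m, hm, hm2⟩ := hs1 ((N + 1) * w.length)
  have hge : N + 1 ≤ m / w.length := (Nat.le_div_iff_mul_le hL).mpr hm
  obtain ⟨c, hc⟩ := Nat.exists_eq_add_of_le' (show 1 ≤ m / w.length by omega)
  obtain ⟨l, hl, hl2⟩ := hblock (c + 1)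
  rw [hP, hP, hN' c (by omega), hN' (c + 1) (by omega)] at hl
  refine ((q1 (P N)).2 l hl).2 (some q) ?_ q hq rfl
  rw [hl2]
  refine ⟨m % w.length, (Nat.mod_lt _ hL).le, ?_⟩
  rw [← hc, Nat.div_add_mod', hm2]

theorem visP_of_run (n k : ℕ) (F : Fin k → Finset (Fin (n - 1))) (w : List (FBAlpha n))
    (p q : FBState n) (l : List (FBState n)) (J : Set (Fin k))
    (h : RunFromTo (FBgen n k F).Δ w p q l)
    (hJ : ∀ i ∈ J, ∃ s ∈ l, ∃ r ∈ F i, s = some r) :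
    VisP (FBgen n k F).Δ (FBgen n k F).F w p q J := by
  obtain ⟨σ, h1, h2⟩ := path_of_run _ _ _ _ h
  refine ⟨σ, h1, ?_⟩
  intro i hi
  obtain ⟨s, hs, r, hr, rfl⟩ := hJ i hi
  obtain ⟨t, ht, h⟩ := (h2 _).mp hs
  exact ⟨t, ht, r, hr, h⟩

theorem seg_loop (n k : ℕ) (F : Fin k → Finset (Fin (n - 1))) (f : Fin (n - 1) → ℕ)
    (g : Fin (n - 1) → Fin k) (w : List (FBAlpha n))
    (hw : IsSegGen n k F f g w) (p : Fin (n - 1)) :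
    VisP (FBgen n k F).Δ (FBgen n k F).F w (some p) (some p) {i : Fin k | i ≠ g p} := by
  obtain ⟨w0, q0, q1, q2, q3⟩ := hw
  obtain ⟨⟨l, hl, -⟩, h⟩ := q1 p
  exact visP_of_run n k F w _ _ l _ hl (fun i hi => (h l hl).1 i hi)

theorem seg_down (n k : ℕ) (F : Fin k → Finset (Fin (n - 1))) (f : Fin (n - 1) → ℕ)
    (g : Fin (n - 1) → Fin k) (w : List (FBAlpha n))
    (hw : IsSegGen n k F f g w) (p q : Fin (n - 1)) (hpq : f q < f p) :
    VisP (FBgen n k F).Δ (FBgen n k F).F w (some p) (some q) Set.univ := by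
  obtain ⟨w0, q0, q1, q2, q3⟩ := hw
  obtain ⟨⟨l, hl, -⟩, h⟩ := q2 p q hpq
  exact visP_of_run n k F w _ _ l _ hl (fun i _ => h l hl i)

theorem seg_conflict (n k : ℕ) (F : Fin k → Finset (Fin (n - 1))) (f₁ f₂ : Fin (n - 1) → ℕ)
    (g₁ g₂ : Fin (n - 1) → Fin k) (w₁ w₂ : List (FBAlpha n))
    (h₁ : PGCL n k F f₁ g₁) (h₂ : PGCL n k F f₂ g₂)
    (hw₁ : IsSegGen n k F f₁ g₁ w₁) (hw₂ : IsSegGen n k F f₂ g₂ w₂)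
    (hne : (f₁, g₁) ≠ (f₂, g₂)) : Conflict (FBgen n k F) w₁ w₂ ∧ w₁ ≠ w₂ := by
  have hv : ∀ k₁ k₂, 0 < k₁ → listPow w₁ k₁ ++ listPow w₂ k₂ ≠ [] := by
    intro k₁ k₂ h
    obtain ⟨c, rfl⟩ := Nat.exists_eq_succ_of_ne_zero h.ne'
    rw [Nat.succ_eq_add_one, listPow_succ']
    simp [hw₁.1]
  by_cases hf : f₁ = f₂
  · have hg : g₁ ≠ g₂ := fun h => hne (by rw [hf, h])
    obtain ⟨p, hp⟩ := Function.ne_iff.mp hg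
    have l1 := seg_loop n k F f₁ g₁ w₁ hw₁ p
    have l2 := seg_loop n k F f₂ g₂ w₂ hw₂ p
    constructor
    · intro k₀ k₁ k₂ hk₀ hk₁ hk₂ α hα
      refine omega_acc (FBgen n k F) _ _ (some p) (some p) (hv _ _ hk₁) trivial (l1.pow0 k₀) ?_ α hα
      refine ((l1.pow1 l1 k₁ hk₁).append (l2.pow1 l2 k₂ hk₂)).mono ?_
      intro i _
      by_cases h : i = g₁ p
      · right
        show i ≠ g₂ p
        rw [h]; exact hp
      · left; exact h
    · rintro rfl
      obtain ⟨⟨l, hl, -⟩, h⟩ := hw₁.2.2.1 p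
      obtain ⟨s, hs, q, hq, rfl⟩ := ((hw₂.2.2.1 p).2 l hl).1 (g₁ p) hp
      exact (h l hl).2 _ hs q hq rfl
  · obtain ⟨p, q, hpq, hqp⟩ := ranking_sep (n - 1) f₁ f₂ h₁.1 h₁.2.2.1 h₂.1 h₂.2.1 h₂.2.2.1 h₁.2.1 hf
    have l1 := seg_loop n k F f₁ g₁ w₁ hw₁
    have l2 := seg_loop n k F f₂ g₂ w₂ hw₂
    have d1 := seg_down n k F f₁ g₁ w₁ hw₁ p q hpq
    have d2 := seg_down n k F f₂ g₂ w₂ hw₂ q p hqp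
    constructor
    · intro k₀ k₁ k₂ hk₀ hk₁ hk₂ α hα
      refine omega_acc (FBgen n k F) _ _ (some p) (some p) (hv _ _ hk₁) trivial
        ((l1 p).pow0 k₀) ?_ α hα
      exact ((d1.pow1 (l1 q) k₁ hk₁).append (d2.pow1 (l2 p) k₂ hk₂)).mono (by simp)
    · rintro rfl
      obtain ⟨⟨l, hl, -⟩, h⟩ := hw₁.2.2.2.1 p q hpq
      exact hw₂.2.2.2.2 p q hqp ⟨l, hl⟩

theorem pgcl_finite (n k : ℕ) (F : Fin k → Finset (Fin (n - 1))) :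
    {fg : (Fin (n - 1) → ℕ) × (Fin (n - 1) → Fin k) | PGCL n k F fg.1 fg.2}.Finite := by
  apply Set.Finite.subset
    (Set.Finite.prod (Set.Finite.pi (fun _ : Fin (n - 1) => Set.finite_Icc 1 (n - 1)))
      (Set.finite_univ (α := Fin (n - 1) → Fin k)))
  rintro ⟨f, g⟩ h
  exact ⟨fun p _ => h.1 p, trivial⟩

theorem pgcl_count (n k : ℕ) (F : Fin k → Finset (Fin (n - 1))) (hF : GoodAcc n k F) :
    (n - 1).factorial * (k / 2) ^ (n - 1) ≤
      Nat.card {fg : (Fin (n - 1) → ℕ) × (Fin (n - 1) → Fin k) // PGCL n k F fg.1 fg.2} := by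
  have hfin : Finite {fg : (Fin (n - 1) → ℕ) × (Fin (n - 1) → Fin k) // PGCL n k F fg.1 fg.2} :=
    (pgcl_finite n k F).to_subtype
  let Φ : Equiv.Perm (Fin (n - 1)) × ((q : Fin (n - 1)) → {i : Fin k | q ∉ F i}) →
      {fg : (Fin (n - 1) → ℕ) × (Fin (n - 1) → Fin k) // PGCL n k F fg.1 fg.2} :=
    fun x => ⟨(fun p => (x.1 p : ℕ) + 1, fun q => (x.2 q).1), by
      refine ⟨fun p => ⟨by simp, by have := (x.1 p).2; simp only []; omega⟩, ?_, ?_, fun q => (x.2 q).2⟩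
      · intro a b h
        simp only [Nat.add_right_cancel_iff] at h
        exact x.1.injective (Fin.ext h)
      · intro r h1 h2
        refine ⟨x.1.symm ⟨r - 1, by omega⟩, ?_⟩
        simp only [Equiv.apply_symm_apply]
        omega⟩
  have hinj : Function.Injective Φ := by
    rintro ⟨e, g⟩ ⟨e', g'⟩ h
    have h := Prod.ext_iff.mp (Subtype.ext_iff.mp h)
    refine Prod.ext (Equiv.ext fun p => Fin.ext ?_) (funext fun q => Subtype.ext ?_)
    · have h3 : (e p : ℕ) + 1 = (e' p : ℕ) + 1 := congrFun h.1 p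
      exact Nat.add_right_cancel h3
    · exact congrFun h.2 q
  refine le_trans ?_ (Nat.card_le_card_of_injective Φ hinj)
  rw [Nat.card_prod, Nat.card_pi, Nat.card_perm, Nat.card_fin]
  refine Nat.mul_le_mul_left _ ?_
  calc (k / 2) ^ (n - 1) = ∏ _q : Fin (n - 1), (k / 2) := by simp
    _ ≤ _ := Finset.prod_le_prod' (fun q _ => hF.2.2 q)

/-- the segments `seg f g` for the PGCL-rankings of `FB (n,k)` form a
conflict set of cardinality at least `(n-1)! ⌊k/2⌋^{n-1}`. -/
theorem pgcl_segments_conflict_set (n k : ℕ) (hn : 1 < n) (hk1 : 1 < k)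
    (hk2 : k ≤ (n - 1).choose ((n - 1) / 2))
    (F : Fin k → Finset (Fin (n - 1))) (hF : GoodAcc n k F)
    (seg : (Fin (n - 1) → ℕ) → (Fin (n - 1) → Fin k) → List (FBAlpha n))
    (hseg : ∀ f g, PGCL n k F f g → IsSegGen n k F f g (seg f g)) :
    (∀ f g, PGCL n k F f g → GCSeg (FBgen n k F) (seg f g)) ∧
    (∀ f₁ g₁ f₂ g₂, PGCL n k F f₁ g₁ → PGCL n k F f₂ g₂ → (f₁, g₁) ≠ (f₂, g₂) →
      Conflict (FBgen n k F) (seg f₁ g₁) (seg f₂ g₂) ∧ seg f₁ g₁ ≠ seg f₂ g₂) ∧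
    ((n - 1).factorial * (k / 2) ^ (n - 1) ≤
      Nat.card {fg : (Fin (n - 1) → ℕ) × (Fin (n - 1) → Fin k) // PGCL n k F fg.1 fg.2}) ∧
    ((n - 1).factorial * (k / 2) ^ (n - 1) ≤
      {w : List (FBAlpha n) | ∃ f g, PGCL n k F f g ∧ seg f g = w}.ncard) := by
  have hb : ∀ f₁ g₁ f₂ g₂, PGCL n k F f₁ g₁ → PGCL n k F f₂ g₂ → (f₁, g₁) ≠ (f₂, g₂) →
      Conflict (FBgen n k F) (seg f₁ g₁) (seg f₂ g₂) ∧ seg f₁ g₁ ≠ seg f₂ g₂ :=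
    fun f₁ g₁ f₂ g₂ h₁ h₂ hne =>
      seg_conflict n k F f₁ f₂ g₁ g₂ _ _ h₁ h₂ (hseg _ _ h₁) (hseg _ _ h₂) hne
  have hc := pgcl_count n k F hF
  refine ⟨fun f g h => seg_gc n k F f g _ h.2.1 (hseg f g h), hb, hc, ?_⟩
  have himg : {w : List (FBAlpha n) | ∃ f g, PGCL n k F f g ∧ seg f g = w} =
      (fun fg : (Fin (n - 1) → ℕ) × (Fin (n - 1) → Fin k) => seg fg.1 fg.2) ''
        {fg | PGCL n k F fg.1 fg.2} := by
    ext w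
    constructor
    · rintro ⟨f, g, h, rfl⟩
      exact ⟨(f, g), h, rfl⟩
    · rintro ⟨⟨f, g⟩, h, rfl⟩
      exact ⟨f, g, h, rfl⟩
  rw [himg, Set.InjOn.ncard_image]
  · exact hc
  · rintro ⟨f₁, g₁⟩ h₁ ⟨f₂, g₂⟩ h₂ h
    by_contra hne
    exact (hb f₁ g₁ f₂ g₂ h₁ h₂ hne).2 h


end YanPaper
end
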